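/- arXiv:math/0609600 — 5 statements merged into one kernel-verified Lean document; each statement's English description precedes it below -/
import Mathlib

section
/- Let B be a Boolean algebra. Then for every choice of binary operations f, g ∈ { ⊓, ⊔ } on B and all x, y, z ∈ B: (f((g(x,y))ᶜ, z))ᶜ = g((f(xᶜ, z))ᶜ, (f(yᶜ, z))ᶜ), where ᶜ denotes complementation. -/
/-- In a Boolean algebra, the identity `F(G(x,y)', z)' ≈ G(F(x',z)', F(y',z)')`
holds as an `M_F(τ)`-hyperidentity: for every assignment of the binary operation
symbols `F`, `G` to the fundamental operations `⊓` and `⊔`. -/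
theorem booleanAlgebra_hyperidentity {B : Type*} [BooleanAlgebra B] :
    ∀ f ∈ ({fun x y => x ⊓ y, fun x y => x ⊔ y} : Set (B → B → B)),
      ∀ g ∈ ({fun x y => x ⊓ y, fun x y => x ⊔ y} : Set (B → B → B)),
        ∀ x y z : B, (f (g x y)ᶜ z)ᶜ = g (f xᶜ z)ᶜ (f yᶜ z)ᶜ := by
  rintro f (rfl | rfl) g (rfl | rfl) x y z <;>
    simp only [compl_inf, compl_sup, compl_compl]
  · exact sup_inf_right x y zᶜ
  · exact sup_sup_distrib_right x y zᶜ
  · exact inf_inf_distrib_right x y zᶜ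
  · exact inf_sup_right x y zᶜ
end

section
/- Let τ be a type containing a binary operation symbol ∧ and a nullary symbol 0, and let A be a flat algebra of type τ. Let σ be a hypersubstitution of type τ with σ(0) = 0 and σ(x₁ ∧ x₂) = x₁ ∧ x₂, and such that for every n-ary operation symbol f with n ≥ 1, the term σ(f) is not a variable and every one of the variables x₁, …, xₙ occurs in σ(f). Then the derived algebra A^σ is a flat algebra. -/
/-- Terms of a type `τ = (I, ar)`. -/
inductive Trm (I : Type) (ar : I → ℕ) : Type
  | var : ℕ → Trm I ar
  | app (f : I) : (Fin (ar f) → Trm I ar) → Trm I ar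

variable {I : Type} {ar : I → ℕ}

/-- Simultaneous substitution of terms for variables. -/
def Trm.subst (δ : ℕ → Trm I ar) : Trm I ar → Trm I ar
  | .var n => δ n
  | .app f ts => .app f fun i => (ts i).subst δ

/-- A hypersubstitution assigns to each operation symbol a term. -/
def Hyp (I : Type) (ar : I → ℕ) := (f : I) → Trm I ar

/-- The extension of a hypersubstitution to all terms. -/
def Hyp.apply (σ : Hyp I ar) : Trm I ar → Trm I ar
  | .var n => .var n
  | .app f ts => (σ f).subst fun n => if h : n < ar f then σ.apply (ts ⟨n, h⟩) else .var n

/-- Occurrence of the variable `m` in a term. -/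
inductive Occurs (m : ℕ) : Trm I ar → Prop
  | var : Occurs m (.var m)
  | app {f ts} (i : Fin (ar f)) : Occurs m (ts i) → Occurs m (.app f ts)

variable {A : Type}

/-- Evaluation of a term in an algebra `(A, ops)` under an assignment `v`. -/
def evalT (ops : (f : I) → (Fin (ar f) → A) → A) (v : ℕ → A) : Trm I ar → A
  | .var n => v n
  | .app f ts => ops f fun i => evalT ops v (ts i)

/-- The operations of the derived algebra `A^σ`: the `f`-th operation sends
`(a₁, …, aₙ)` to the realization of the term `σ(f)` in `A` at `(a₁, …, aₙ)`
(variables beyond the arity of `f` — which do not occur in `σ(f)` for a genuine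
hypersubstitution — get the default value `d`). -/
def derOps (ops : (f : I) → (Fin (ar f) → A) → A) (σ : Hyp I ar) (d : A) :
    (f : I) → (Fin (ar f) → A) → A :=
  fun f a => evalT ops (fun n => if h : n < ar f then a ⟨n, h⟩ else d) (σ f)

/-- The binary operation interpreting the meet symbol `w`. -/
def meetOf (w : I) (ops : (f : I) → (Fin (ar f) → A) → A) (a b : A) : A :=
  ops w fun i => if (i : ℕ) = 0 then a else b

/-- The element interpreting the nullary symbol `z`. -/
def zeroOf (z : I) (hz : ar z = 0) (ops : (f : I) → (Fin (ar f) → A) → A) : A :=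
  ops z fun i => (Fin.cast hz i).elim0

/-- `(A, ops)` is a 0-semilattice `τ`-algebra: `∧` is associative, commutative
and idempotent, and every operation returns `0` whenever some argument is `0`. -/
def IsZeroSemilat (w z : I) (hz : ar z = 0) (ops : (f : I) → (Fin (ar f) → A) → A) : Prop :=
  (∀ a b c : A, meetOf w ops (meetOf w ops a b) c = meetOf w ops a (meetOf w ops b c)) ∧
  (∀ a b : A, meetOf w ops a b = meetOf w ops b a) ∧
  (∀ a : A, meetOf w ops a a = a) ∧
  (∀ (f : I) (t : Fin (ar f) → A),
    (∃ j, t j = zeroOf z hz ops) → ops f t = zeroOf z hz ops)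

/-- `(A, ops)` is a flat algebra: a 0-semilattice algebra in which the meet of
any two distinct elements is `0`. -/
def IsFlat (w z : I) (hz : ar z = 0) (ops : (f : I) → (Fin (ar f) → A) → A) : Prop :=
  IsZeroSemilat w z hz ops ∧ ∀ a b : A, a ≠ b → meetOf w ops a b = zeroOf z hz ops

theorem evalT_eq_zero_of_occurs {z : I} {hz : ar z = 0} {ops : (f : I) → (Fin (ar f) → A) → A}
    (hops : ∀ (f : I) (t : Fin (ar f) → A),
      (∃ j, t j = zeroOf z hz ops) → ops f t = zeroOf z hz ops)
    {v : ℕ → A} {m : ℕ} (hv : v m = zeroOf z hz ops) {t : Trm I ar} (h : Occurs m t) :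
    evalT ops v t = zeroOf z hz ops := by
  induction h with
  | var => exact hv
  | app i _ ih => exact hops _ _ ⟨i, ih⟩

theorem derOps_of_app_var {ops : (f : I) → (Fin (ar f) → A) → A} {σ : Hyp I ar} {d : A} {f : I}
    (h : σ f = .app f fun i => .var i) : derOps ops σ d f = ops f := by
  funext a
  simp [derOps, h, evalT]

/-- If `A` is a flat algebra and `σ` is a hypersubstitution leaving `0` and `∧`
unchanged such that for every `n`-ary symbol `f` with `n ≥ 1` the term `σ(f)`
is not a variable and all variables `x₁, …, xₙ` occur in `σ(f)`, then the
derived algebra `A^σ` is a flat algebra. -/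
theorem flat_derived_flat (w z : I) (hw : ar w = 2) (hz : ar z = 0)
    (ops : (f : I) → (Fin (ar f) → A) → A) (hA : IsFlat w z hz ops)
    (σ : Hyp I ar)
    (hσwf : ∀ (f : I) (m : ℕ), Occurs m (σ f) → m < ar f)
    (hσz : σ z = .app z fun i => .var i)
    (hσw : σ w = .app w fun i => .var i)
    (hσf : ∀ f : I, 1 ≤ ar f →
      (∀ m : ℕ, σ f ≠ .var m) ∧ ∀ m : ℕ, m < ar f → Occurs m (σ f)) :
    IsFlat w z hz (derOps ops σ (zeroOf z hz ops)) := by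
  have hmeet (a b : A) : meetOf w (derOps ops σ (zeroOf z hz ops)) a b = meetOf w ops a b := by
    rw [meetOf, derOps_of_app_var hσw, meetOf]
  have hzero : zeroOf z hz (derOps ops σ (zeroOf z hz ops)) = zeroOf z hz ops := by
    rw [zeroOf, derOps_of_app_var hσz, zeroOf]
  obtain ⟨⟨assoc, comm, idem, absorb⟩, flat⟩ := hA
  simp only [IsFlat, IsZeroSemilat, hmeet, hzero]
  refine ⟨⟨assoc, comm, idem, ?_⟩, flat⟩
  rintro f t ⟨j, hj⟩
  have hocc := (hσf f (Nat.one_le_of_lt j.isLt)).2 j j.isLt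
  exact evalT_eq_zero_of_occurs absorb (by simpa using hj) hocc
end

section
/- Let τ be a type containing a binary operation symbol ∧ and a nullary symbol 0, and let σ be a hypersubstitution of type τ such that for every n-ary operation symbol f, σ(f) = g(x₁,…,xₙ) for some n-ary operation symbol g, with σ(0) = 0 and σ(x₁ ∧ x₂) = x₁ ∧ x₂. If A is a 0-semilattice τ-algebra, then the derived algebra A^σ is a 0-semilattice τ-algebra. -/
variable {I : Type} {ar : I → ℕ}

variable {A : Type}

/-- If `σ(f) = g(x₁,…,xₙ)` then the derived operation of `f` is that of `g`. -/
theorem derOps_of_eq_app (ops : (f : I) → (Fin (ar f) → A) → A) (σ : Hyp I ar) (d : A)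
    {f g : I} (hg : ar g = ar f) (h : σ f = .app g fun i => .var i) (a : Fin (ar f) → A) :
    derOps ops σ d f a = ops g (a ∘ Fin.cast hg) := by
  simp only [derOps, h, evalT]
  congr 1
  funext i
  exact dif_pos (i.isLt.trans_eq hg)

/-- If `σ` is a hypersubstitution from `M*_{0,∧}(τ)` — i.e. `σ(f) = g(x₁,…,xₙ)`
for some `n`-ary symbol `g`, with `σ(0) = 0` and `σ(x₁ ∧ x₂) = x₁ ∧ x₂` — and
`A` is a 0-semilattice `τ`-algebra, then the derived algebra `A^σ` is a
0-semilattice `τ`-algebra. -/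
theorem zeroSemilat_derived_zeroSemilat (w z : I) (hw : ar w = 2) (hz : ar z = 0)
    (σ : Hyp I ar)
    (hσ : ∀ f : I, ∃ g : I, ar g = ar f ∧ σ f = .app g fun i => .var i)
    (hσz : σ z = .app z fun i => .var i)
    (hσw : σ w = .app w fun i => .var i)
    (ops : (f : I) → (Fin (ar f) → A) → A) (hA : IsZeroSemilat w z hz ops) :
    IsZeroSemilat w z hz (derOps ops σ (zeroOf z hz ops)) := by
  have hzero : zeroOf z hz (derOps ops σ (zeroOf z hz ops)) = zeroOf z hz ops :=
    (derOps_of_eq_app ops σ _ rfl hσz _).trans rfl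
  have hmeet : meetOf w (derOps ops σ (zeroOf z hz ops)) = meetOf w ops := by
    funext a b
    exact derOps_of_eq_app ops σ _ rfl hσw _
  obtain ⟨hassoc, hcomm, hidem, habs⟩ := hA
  rw [IsZeroSemilat, hzero, hmeet]
  refine ⟨hassoc, hcomm, hidem, ?_⟩
  rintro f t ⟨j, hj⟩
  obtain ⟨g, hg, hf⟩ := hσ f
  rw [derOps_of_eq_app ops σ _ hg hf]
  exact habs g _ ⟨Fin.cast hg.symm j, hj⟩
end

section
/- A set Σ of quasi-identities of type τ is the set of all quasi-identities hypersatisfied in some class K of algebras of type τ if and only if Σ is hyperclosed, i.e., Σ contains all axioms of the calculus Q and is closed under the substitution rule, the hypersubstitution rule, the cut rule, and the extension rule. -/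
open scoped Classical

variable {I : Type} {ar : I → ℕ}

/-- The identity hypersubstitution `σ_id`. -/
def Hyp.id (I : Type) (ar : I → ℕ) : Hyp I ar := fun f => .app f fun i => .var i

/-- Composition of hypersubstitutions: `(σ₁ ∘ σ₂)(f) = σ₁(σ₂(f))`. -/
def Hyp.comp (σ₁ σ₂ : Hyp I ar) : Hyp I ar := fun f => σ₁.apply (σ₂ f)

/-- `σ` is a genuine hypersubstitution: `σ(f)` is an `(ar f)`-ary term,
i.e. its variables are among `x₀, …, x_{ar f - 1}`.  The set `{σ | IsHyp σ}`
plays the role of the monoid `H(τ)` of all hypersubstitutions of type `τ`. -/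
def IsHyp (σ : Hyp I ar) : Prop := ∀ f m, Occurs m (σ f) → m < ar f

/-- An identity `t ≈ s` of type `τ`. -/
abbrev Eqn (I : Type) (ar : I → ℕ) := Trm I ar × Trm I ar

/-- A quasi-identity `Δ → α` of type `τ`: a finite set `Δ` of identities
(the premises) together with an identity `α` (the conclusion). -/
abbrev Quasi (I : Type) (ar : I → ℕ) := Finset (Eqn I ar) × Eqn I ar

/-- Applying a map on terms to every term occurring in a quasi-identity. -/
noncomputable def mapQ (g : Trm I ar → Trm I ar) (q : Quasi I ar) : Quasi I ar :=
  (q.1.image fun p => (g p.1, g p.2), (g q.2.1, g q.2.2))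

/-- An algebra of type `τ`. -/
structure Alg (I : Type) (ar : I → ℕ) where
  carrier : Type
  ops : (f : I) → (Fin (ar f) → carrier) → carrier

/-- Evaluation of a term in an algebra under an assignment `v`. -/
def Alg.eval (A : Alg I ar) (v : ℕ → A.carrier) : Trm I ar → A.carrier
  | .var n => v n
  | .app f ts => A.ops f fun i => A.eval v (ts i)

/-- Satisfaction of a quasi-identity in an algebra: every assignment making all
premises hold makes the conclusion hold. -/
def Alg.Sat (A : Alg I ar) (q : Quasi I ar) : Prop :=
  ∀ v : ℕ → A.carrier,
    (∀ p ∈ q.1, A.eval v p.1 = A.eval v p.2) → A.eval v q.2.1 = A.eval v q.2.2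

/-- `M`-hypersatisfaction of a quasi-identity in an algebra: `A` satisfies
`σ(q)` for every hypersubstitution `σ ∈ M`. -/
def Alg.HypSatM (A : Alg I ar) (M : Set (Hyp I ar)) (q : Quasi I ar) : Prop :=
  ∀ σ ∈ M, A.Sat (mapQ (Hyp.apply σ) q)

/-- The quasi-equational calculus `Q` (when `M = ∅`), resp. its extension by the
hypersubstitution rule for the hypersubstitutions of `M`: `MHQ` for a submonoid
`M ⊆ H(τ)`, and `HQ` when `M = {σ | IsHyp σ} = H(τ)`. -/
inductive Der (M : Set (Hyp I ar)) (S : Set (Quasi I ar)) : Quasi I ar → Prop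
  | hyp {q} : q ∈ S → Der M S q
  | refl (p : Trm I ar) : Der M S (∅, (p, p))
  | assm (α : Eqn I ar) : Der M S ({α}, α)
  | symm (p q : Trm I ar) : Der M S ({(p, q)}, (q, p))
  | trans (p q r : Trm I ar) : Der M S ({(p, q), (q, r)}, (p, r))
  | compat (f : I) (t s : Fin (ar f) → Trm I ar) :
      Der M S (Finset.univ.image fun i => (t i, s i), (.app f t, .app f s))
  | subst {q} (δ : ℕ → Trm I ar) : Der M S q → Der M S (mapQ (Trm.subst δ) q)
  | hypsub {q} {σ : Hyp I ar} : σ ∈ M → Der M S q → Der M S (mapQ (Hyp.apply σ) q)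
  | cut {Δ Γ : Finset (Eqn I ar)} {α β : Eqn I ar} :
      Der M S (Δ, α) → Der M S (insert α Γ, β) → Der M S (Δ ∪ Γ, β)
  | ext {Δ : Finset (Eqn I ar)} {α : Eqn I ar} (β : Eqn I ar) :
      Der M S (Δ, α) → Der M S (insert β Δ, α)

/-- `Σ` is hyperclosed: it contains all axioms of the calculus `Q` and is closed
under the substitution rule, the hypersubstitution rule, the cut rule and the
extension rule. -/
def Hyperclosed (S : Set (Quasi I ar)) : Prop :=
  (∀ p : Trm I ar, (∅, (p, p)) ∈ S) ∧
  (∀ α : Eqn I ar, ({α}, α) ∈ S) ∧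
  (∀ p q : Trm I ar, ({(p, q)}, (q, p)) ∈ S) ∧
  (∀ p q r : Trm I ar, ({(p, q), (q, r)}, (p, r)) ∈ S) ∧
  (∀ (f : I) (t s : Fin (ar f) → Trm I ar),
    (Finset.univ.image fun i => (t i, s i), (Trm.app f t, Trm.app f s)) ∈ S) ∧
  (∀ q ∈ S, ∀ δ : ℕ → Trm I ar, mapQ (Trm.subst δ) q ∈ S) ∧
  (∀ q ∈ S, ∀ σ : Hyp I ar, IsHyp σ → mapQ (Hyp.apply σ) q ∈ S) ∧
  (∀ (Δ Γ : Finset (Eqn I ar)) (α β : Eqn I ar),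
    (Δ, α) ∈ S → (insert α Γ, β) ∈ S → (Δ ∪ Γ, β) ∈ S) ∧
  (∀ (Δ : Finset (Eqn I ar)) (α β : Eqn I ar), (Δ, α) ∈ S → (insert β Δ, α) ∈ S)

theorem Trm.subst_congr {δ ε : ℕ → Trm I ar} :
    ∀ t : Trm I ar, (∀ m, Occurs m t → δ m = ε m) → t.subst δ = t.subst ε
  | .var n, h => h n .var
  | .app f ts, h => by
    simp only [Trm.subst]
    congr 1
    funext i
    exact Trm.subst_congr (ts i) fun m hm => h m (.app i hm)

theorem Trm.subst_subst (δ ε : ℕ → Trm I ar) :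
    ∀ t : Trm I ar, (t.subst δ).subst ε = t.subst fun n => (δ n).subst ε
  | .var _ => rfl
  | .app f ts => by
    simp only [Trm.subst]
    congr 1
    funext i
    exact Trm.subst_subst δ ε (ts i)

theorem Trm.occurs_subst {δ : ℕ → Trm I ar} {m : ℕ} :
    ∀ t : Trm I ar, Occurs m (t.subst δ) → ∃ n, Occurs n t ∧ Occurs m (δ n)
  | .var n, h => ⟨n, .var, h⟩
  | .app f ts, h => by
    cases h with
    | app i hi =>
      obtain ⟨n, hn, hm⟩ := Trm.occurs_subst (ts i) hi
      exact ⟨n, .app i hn, hm⟩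

theorem Trm.subst_var : ∀ t : Trm I ar, t.subst Trm.var = t
  | .var _ => rfl
  | .app f ts => by
    simp only [Trm.subst]
    congr 1
    funext i
    exact Trm.subst_var (ts i)

theorem Hyp.apply_subst {σ : Hyp I ar} (hσ : IsHyp σ) (δ : ℕ → Trm I ar) :
    ∀ t : Trm I ar, σ.apply (t.subst δ) = (σ.apply t).subst fun n => σ.apply (δ n)
  | .var _ => rfl
  | .app f ts => by
    simp only [Trm.subst, Hyp.apply, Trm.subst_subst]
    refine Trm.subst_congr _ fun m hm => ?_
    simp only [dif_pos (hσ f m hm)]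
    exact Hyp.apply_subst hσ δ (ts _)

theorem Hyp.apply_comp {σ₁ : Hyp I ar} (h₁ : IsHyp σ₁) (σ₂ : Hyp I ar) :
    ∀ t : Trm I ar, (σ₁.comp σ₂).apply t = σ₁.apply (σ₂.apply t)
  | .var _ => rfl
  | .app f ts => by
    simp only [Hyp.apply, Hyp.apply_subst h₁, Hyp.comp]
    congr 1
    funext n
    split_ifs with h
    · exact Hyp.apply_comp h₁ σ₂ (ts ⟨n, h⟩)
    · rfl

theorem Hyp.occurs_of_occurs_apply {σ : Hyp I ar} (hσ : IsHyp σ) {m : ℕ} :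
    ∀ t : Trm I ar, Occurs m (σ.apply t) → Occurs m t
  | .var _, h => h
  | .app f ts, h => by
    simp only [Hyp.apply] at h
    obtain ⟨n, hn, hm⟩ := Trm.occurs_subst _ h
    rw [dif_pos (hσ f n hn)] at hm
    exact .app _ (Hyp.occurs_of_occurs_apply hσ (ts _) hm)

theorem IsHyp.comp {σ₁ σ₂ : Hyp I ar} (h₁ : IsHyp σ₁) (h₂ : IsHyp σ₂) :
    IsHyp (σ₁.comp σ₂) :=
  fun f m hm => h₂ f m (Hyp.occurs_of_occurs_apply h₁ _ hm)

theorem Hyp.isHyp_id : IsHyp (Hyp.id I ar) := by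
  intro f m hm
  cases hm with
  | app i hi =>
    cases hi
    exact i.isLt

theorem Hyp.id_apply : ∀ t : Trm I ar, (Hyp.id I ar).apply t = t
  | .var _ => rfl
  | .app f ts => by
    simp only [Hyp.apply, Hyp.id, Trm.subst]
    congr 1
    funext i
    simp only [dif_pos i.isLt]
    exact Hyp.id_apply (ts i)

theorem mapQ_mapQ (g h : Trm I ar → Trm I ar) (q : Quasi I ar) :
    mapQ g (mapQ h q) = mapQ (fun t => g (h t)) q := by
  simp [mapQ, Finset.image_image, Function.comp_def]

theorem mapQ_id (q : Quasi I ar) : mapQ (fun t => t) q = q := by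
  simp [mapQ]

theorem Alg.eval_subst (A : Alg I ar) (v : ℕ → A.carrier) (δ : ℕ → Trm I ar) :
    ∀ t : Trm I ar, A.eval v (t.subst δ) = A.eval (fun n => A.eval v (δ n)) t
  | .var _ => rfl
  | .app f ts => by
    simp only [Trm.subst, Alg.eval]
    congr 1
    funext i
    exact Alg.eval_subst A v δ (ts i)

theorem Alg.sat_mapQ_subst {A : Alg I ar} {q : Quasi I ar} (h : A.Sat q)
    (δ : ℕ → Trm I ar) : A.Sat (mapQ (Trm.subst δ) q) := by
  intro v hv
  simp only [mapQ, Finset.forall_mem_image, Alg.eval_subst] at hv ⊢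
  exact h _ fun p hp => hv hp

/-- The algebra derived from `A` by the hypersubstitution `σ`; the variables of `σ f` beyond
the arity of `f` take their values from `v`. -/
def Alg.derived (A : Alg I ar) (σ : Hyp I ar) (v : ℕ → A.carrier) : Alg I ar where
  carrier := A.carrier
  ops f a := A.eval (fun n => if h : n < ar f then a ⟨n, h⟩ else v n) (σ f)

theorem Alg.eval_apply (A : Alg I ar) (σ : Hyp I ar) (v : ℕ → A.carrier) :
    ∀ t : Trm I ar, A.eval v (σ.apply t) = (A.derived σ v).eval v t
  | .var _ => rfl
  | .app f ts => by
    simp only [Hyp.apply, Alg.eval_subst, Alg.eval, Alg.derived]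
    congr 1
    funext n
    split_ifs with h
    · exact Alg.eval_apply A σ v (ts ⟨n, h⟩)
    · rfl

theorem Alg.sat_mapQ_apply_iff {A : Alg I ar} {σ : Hyp I ar} {q : Quasi I ar} :
    A.Sat (mapQ σ.apply q) ↔ ∀ v : ℕ → A.carrier,
      (∀ p ∈ q.1, (A.derived σ v).eval v p.1 = (A.derived σ v).eval v p.2) →
        (A.derived σ v).eval v q.2.1 = (A.derived σ v).eval v q.2.2 := by
  simp only [Alg.Sat, mapQ, Finset.forall_mem_image, Alg.eval_apply]
  rfl

theorem Alg.HypSatM.of_forall_sat {q : Quasi I ar} (h : ∀ B : Alg I ar, B.Sat q)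
    (A : Alg I ar) (M : Set (Hyp I ar)) : A.HypSatM M q :=
  fun σ _ => Alg.sat_mapQ_apply_iff.2 fun v => h (A.derived σ v) v

theorem hyperclosed_hypersatisfied (K : Set (Alg I ar)) :
    Hyperclosed {q : Quasi I ar | ∀ A ∈ K, A.HypSatM {σ : Hyp I ar | IsHyp σ} q} := by
  refine ⟨fun p A _ => ?_, fun α A _ => ?_, fun p q A _ => ?_, fun p q r A _ => ?_,
    fun f t s A _ => ?_, fun q hq δ A hA σ hσ => ?_, fun q hq σ hσ A hA ρ hρ => ?_,
    fun Δ Γ α β h₁ h₂ A hA σ hσ => ?_, fun Δ α β h A hA σ hσ => ?_⟩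
  · exact .of_forall_sat (fun B v _ => rfl) A _
  · exact .of_forall_sat (fun B v h => h α (by simp)) A _
  · exact .of_forall_sat (fun B v h => (h (p, q) (by simp)).symm) A _
  · exact .of_forall_sat
      (fun B v h => (h (p, q) (by simp)).trans (h (q, r) (by simp))) A _
  · refine .of_forall_sat (fun B v h => ?_) A _
    simp only [Alg.eval]
    congr 1
    funext i
    exact h (t i, s i) (Finset.mem_image_of_mem _ (Finset.mem_univ i))
  · have := Alg.sat_mapQ_subst (hq A hA σ hσ) fun n => σ.apply (δ n)
    rw [mapQ_mapQ] at this ⊢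
    simpa only [Hyp.apply_subst hσ] using this
  · have := hq A hA (ρ.comp σ) (IsHyp.comp hρ hσ)
    rw [mapQ_mapQ]
    simpa only [← Hyp.apply_comp hρ] using this
  · have h₁ := Alg.sat_mapQ_apply_iff.1 (h₁ A hA σ hσ)
    have h₂ := Alg.sat_mapQ_apply_iff.1 (h₂ A hA σ hσ)
    refine Alg.sat_mapQ_apply_iff.2 fun v hv => h₂ v ?_
    intro p hp
    rcases Finset.mem_insert.1 hp with rfl | hp
    · exact h₁ v fun p hp => hv p (Finset.mem_union_left _ hp)
    · exact hv p (Finset.mem_union_right _ hp)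
  · have h := Alg.sat_mapQ_apply_iff.1 (h A hA σ hσ)
    exact Alg.sat_mapQ_apply_iff.2 fun v hv =>
      h v fun p hp => hv p (Finset.mem_insert_of_mem hp)

namespace Hyperclosed

variable {S : Set (Quasi I ar)}

theorem refl_mem (hS : Hyperclosed S) (p : Trm I ar) : (∅, (p, p)) ∈ S := hS.1 p

theorem assm_mem (hS : Hyperclosed S) (α : Eqn I ar) : ({α}, α) ∈ S := hS.2.1 α

theorem symm_mem (hS : Hyperclosed S) (p q : Trm I ar) : ({(p, q)}, (q, p)) ∈ S :=
  hS.2.2.1 p q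

theorem trans_mem (hS : Hyperclosed S) (p q r : Trm I ar) :
    ({(p, q), (q, r)}, (p, r)) ∈ S := hS.2.2.2.1 p q r

theorem compat_mem (hS : Hyperclosed S) (f : I) (t s : Fin (ar f) → Trm I ar) :
    (Finset.univ.image fun i => (t i, s i), (Trm.app f t, Trm.app f s)) ∈ S :=
  hS.2.2.2.2.1 f t s

theorem subst_mem (hS : Hyperclosed S) {q : Quasi I ar} (hq : q ∈ S) (δ : ℕ → Trm I ar) :
    mapQ (Trm.subst δ) q ∈ S := hS.2.2.2.2.2.1 q hq δ

theorem hypsub_mem (hS : Hyperclosed S) {q : Quasi I ar} (hq : q ∈ S) {σ : Hyp I ar}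
    (hσ : IsHyp σ) : mapQ σ.apply q ∈ S := hS.2.2.2.2.2.2.1 q hq σ hσ

theorem cut_mem (hS : Hyperclosed S) {Δ Γ : Finset (Eqn I ar)} {α β : Eqn I ar}
    (h₁ : (Δ, α) ∈ S) (h₂ : (insert α Γ, β) ∈ S) : (Δ ∪ Γ, β) ∈ S :=
  hS.2.2.2.2.2.2.2.1 Δ Γ α β h₁ h₂

theorem ext_mem (hS : Hyperclosed S) {Δ : Finset (Eqn I ar)} {α : Eqn I ar}
    (h : (Δ, α) ∈ S) (β : Eqn I ar) : (insert β Δ, α) ∈ S :=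
  hS.2.2.2.2.2.2.2.2 Δ α β h

theorem union_mem (hS : Hyperclosed S) {Δ : Finset (Eqn I ar)} {α : Eqn I ar}
    (h : (Δ, α) ∈ S) (Γ : Finset (Eqn I ar)) : (Γ ∪ Δ, α) ∈ S := by
  induction Γ using Finset.induction_on with
  | empty => simpa using h
  | insert a Γ _ ih => simpa only [Finset.insert_union] using hS.ext_mem ih a

theorem mem_of_subset (hS : Hyperclosed S) {Δ Γ : Finset (Eqn I ar)} {α : Eqn I ar}
    (h : (Δ, α) ∈ S) (hΔ : Δ ⊆ Γ) : (Γ, α) ∈ S := by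
  simpa only [Finset.union_eq_left.2 hΔ] using hS.union_mem h Γ

/-- Simultaneous cut of all premises. -/
theorem cut_all (hS : Hyperclosed S) {Γ Δ : Finset (Eqn I ar)} {β : Eqn I ar}
    (h : (Γ, β) ∈ S) (hΓ : ∀ p ∈ Γ, (Δ, p) ∈ S) : (Δ, β) ∈ S := by
  replace h : (Γ ∪ Δ, β) ∈ S := hS.mem_of_subset h Finset.subset_union_left
  induction Γ using Finset.induction_on with
  | empty => simpa using h
  | insert a Γ _ ih =>
    refine ih (fun p hp => hΓ p (Finset.mem_insert_of_mem hp)) ?_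
    rw [Finset.insert_union] at h
    have := hS.cut_mem (hΓ a (Finset.mem_insert_self a Γ)) h
    rwa [Finset.union_eq_right.2 Finset.subset_union_right] at this

/-- Two terms are related when their identity follows from the premises `Δ` in `S`. -/
def termSetoid (hS : Hyperclosed S) (Δ : Finset (Eqn I ar)) : Setoid (Trm I ar) where
  r t s := (Δ, (t, s)) ∈ S
  iseqv :=
    { refl := fun t => hS.mem_of_subset (hS.refl_mem t) (Finset.empty_subset Δ)
      symm := fun {t s} h => hS.cut_all (hS.symm_mem t s) (by simpa using h)
      trans := fun {t s r} h₁ h₂ => hS.cut_all (hS.trans_mem t s r) (by simp [h₁, h₂]) }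

/-- The quotient of the term algebra by the congruence `hS.termSetoid Δ`. -/
noncomputable def termAlg (hS : Hyperclosed S) (Δ : Finset (Eqn I ar)) : Alg I ar where
  carrier := Quotient (hS.termSetoid Δ)
  ops f a := Quotient.mk _ (.app f fun i => (a i).out)

theorem termAlg_eval (hS : Hyperclosed S) (Δ : Finset (Eqn I ar)) (δ : ℕ → Trm I ar) :
    ∀ t : Trm I ar, (hS.termAlg Δ).eval (fun n => Quotient.mk (hS.termSetoid Δ) (δ n)) t =
      Quotient.mk (hS.termSetoid Δ) (t.subst δ)
  | .var _ => rfl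
  | .app f ts => by
    simp only [Alg.eval, Trm.subst, termAlg]
    refine Quotient.sound (hS.cut_all (hS.compat_mem f _ _) ?_)
    simp only [Finset.forall_mem_image]
    intro i _
    exact Quotient.exact ((Quotient.out_eq _).trans (termAlg_eval hS Δ δ (ts i)))

theorem termAlg_eval_eq_iff (hS : Hyperclosed S) {Δ : Finset (Eqn I ar)}
    {δ : ℕ → Trm I ar} {t s : Trm I ar} :
    (hS.termAlg Δ).eval (fun n => Quotient.mk (hS.termSetoid Δ) (δ n)) t =
      (hS.termAlg Δ).eval (fun n => Quotient.mk (hS.termSetoid Δ) (δ n)) s ↔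
      (Δ, (t.subst δ, s.subst δ)) ∈ S := by
  rw [termAlg_eval, termAlg_eval]
  exact Quotient.eq

theorem termAlg_sat (hS : Hyperclosed S) (Δ : Finset (Eqn I ar)) {q : Quasi I ar}
    (hq : q ∈ S) : (hS.termAlg Δ).Sat q := by
  intro v
  obtain ⟨δ, rfl⟩ : ∃ δ : ℕ → Trm I ar, v = fun n => Quotient.mk (hS.termSetoid Δ) (δ n) :=
    ⟨fun n => (v n).out, funext fun n => (Quotient.out_eq (v n)).symm⟩
  simp only [termAlg_eval_eq_iff]
  intro h
  refine hS.cut_all (hS.subst_mem hq δ) ?_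
  simpa only [Finset.forall_mem_image] using fun p hp => h p hp

theorem mem_of_termAlg_sat (hS : Hyperclosed S) {q : Quasi I ar}
    (h : (hS.termAlg q.1).Sat q) : q ∈ S := by
  have := h fun n => Quotient.mk (hS.termSetoid q.1) (.var n)
  simp only [termAlg_eval_eq_iff, Trm.subst_var] at this
  exact this fun p hp => hS.mem_of_subset (hS.assm_mem p) (Finset.singleton_subset_iff.2 hp)

end Hyperclosed

/-- A set `Σ` of quasi-identities of type `τ` is the set of all quasi-identities
hypersatisfied in some class `K` of algebras of type `τ` if and only if `Σ` is
hyperclosed. -/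
theorem hypersatisfied_iff_hyperclosed (S : Set (Quasi I ar)) :
    (∃ K : Set (Alg I ar),
        S = {q : Quasi I ar | ∀ A ∈ K, A.HypSatM {σ : Hyp I ar | IsHyp σ} q}) ↔
      Hyperclosed S := by
  constructor
  · rintro ⟨K, rfl⟩
    exact hyperclosed_hypersatisfied K
  · intro hS
    refine ⟨{A | ∀ q ∈ S, A.Sat q}, Set.Subset.antisymm ?_ ?_⟩
    · exact fun q hq A hA σ hσ => hA _ (hS.hypsub_mem hq hσ)
    · intro q hq
      have h := hq (hS.termAlg q.1) (fun p hp => hS.termAlg_sat q.1 hp) _ Hyp.isHyp_id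
      rw [show (Hyp.id I ar).apply = fun t => t from funext Hyp.id_apply, mapQ_id] at h
      exact hS.mem_of_termAlg_sat h
end

section
/- Let M be a submonoid of the monoid H(τ) of hypersubstitutions of type τ. An identity e of type τ is an M-hyperconsequence of a set Σ of quasi-identities of type τ if and only if, for every hypersubstitution σ ∈ M, there is a derivation of σ(e) from E ∪ Σ using only the substitution rule, the modus ponens rule, and the M-hypersubstitution rule, where E is the set of equality axioms of type τ. -/
open scoped Classical

variable {I : Type} {ar : I → ℕ}

/-- The set `E` of equality axioms of type `τ`: reflexivity, symmetry,
transitivity and compatibility. -/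
def Eax (I : Type) (ar : I → ℕ) : Set (Quasi I ar) :=
  {q | (∃ p : Trm I ar, q = (∅, (p, p))) ∨
    (∃ p r : Trm I ar, q = ({(p, r)}, (r, p))) ∨
    (∃ p r s : Trm I ar, q = ({(p, r), (r, s)}, (p, s))) ∨
    (∃ (f : I) (t s : Fin (ar f) → Trm I ar),
      q = (Finset.univ.image fun i => (t i, s i), (Trm.app f t, Trm.app f s)))}

/-- Derivations using only the substitution rule, the `M`-hypersubstitution rule
(for `σ ∈ M`) and the modus ponens rule. -/
inductive DerMP (M : Set (Hyp I ar)) (S : Set (Quasi I ar)) : Quasi I ar → Prop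
  | hyp {q} : q ∈ S → DerMP M S q
  | subst {q} (δ : ℕ → Trm I ar) : DerMP M S q → DerMP M S (mapQ (Trm.subst δ) q)
  | hypsub {q} {σ : Hyp I ar} : σ ∈ M → DerMP M S q → DerMP M S (mapQ (Hyp.apply σ) q)
  | mp {Δ : Finset (Eqn I ar)} {α β : Eqn I ar} :
      DerMP M S (∅, α) → DerMP M S (insert α Δ, β) → DerMP M S (Δ, β)

namespace Trm

theorem subst_var_s15 (t : Trm I ar) : t.subst .var = t := by
  induction t with
  | var n => rfl
  | app f ts ih => simp only [subst, ih]

theorem subst_subst_s15 (δ ε : ℕ → Trm I ar) (t : Trm I ar) :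
    (t.subst δ).subst ε = t.subst fun n => (δ n).subst ε := by
  induction t with
  | var n => rfl
  | app f ts ih => simp only [subst, ih]

theorem subst_congr_s15 {δ ε : ℕ → Trm I ar} {t : Trm I ar}
    (h : ∀ n, Occurs n t → δ n = ε n) : t.subst δ = t.subst ε := by
  induction t with
  | var n => exact h n .var
  | app f ts ih =>
    simp only [subst]
    congr 1
    funext i
    exact ih i fun n hn => h n (.app i hn)

end Trm

namespace Hyp

theorem id_apply_s15 (t : Trm I ar) : (Hyp.id I ar).apply t = t := by
  induction t with
  | var n => rfl
  | app f ts ih => simp [apply, Hyp.id, Trm.subst, ih]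

theorem apply_subst_s15 {σ : Hyp I ar} (hσ : IsHyp σ) (δ : ℕ → Trm I ar) (t : Trm I ar) :
    σ.apply (t.subst δ) = (σ.apply t).subst fun n => σ.apply (δ n) := by
  induction t with
  | var n => rfl
  | app f ts ih =>
    simp only [Trm.subst, apply, Trm.subst_subst_s15]
    refine Trm.subst_congr_s15 fun n hn => ?_
    simp [hσ f n hn, ih]

theorem comp_apply {σ₁ σ₂ : Hyp I ar} (h₁ : IsHyp σ₁) (t : Trm I ar) :
    (σ₁.comp σ₂).apply t = σ₁.apply (σ₂.apply t) := by
  induction t with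
  | var n => rfl
  | app f ts ih =>
    simp only [apply, comp, apply_subst_s15 h₁]
    congr 1
    funext n
    split
    · exact ih _
    · rfl

end Hyp

namespace Alg

theorem eval_subst_s15 (A : Alg I ar) (v : ℕ → A.carrier) (δ : ℕ → Trm I ar) (t : Trm I ar) :
    A.eval v (t.subst δ) = A.eval (fun n => A.eval v (δ n)) t := by
  induction t with
  | var n => rfl
  | app f ts ih => simp only [Trm.subst, eval, ih]

theorem eval_congr (A : Alg I ar) {v w : ℕ → A.carrier} {t : Trm I ar}
    (h : ∀ n, Occurs n t → v n = w n) : A.eval v t = A.eval w t := by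
  induction t with
  | var n => exact h n .var
  | app f ts ih =>
    simp only [eval]
    congr 1
    funext i
    exact ih i fun n hn => h n (.app i hn)

theorem sat_mapQ {A : Alg I ar} {g : Trm I ar → Trm I ar} {q : Quasi I ar} :
    A.Sat (mapQ g q) ↔ ∀ v : ℕ → A.carrier,
      (∀ p ∈ q.1, A.eval v (g p.1) = A.eval v (g p.2)) →
        A.eval v (g q.2.1) = A.eval v (g q.2.2) := by
  simp only [Sat, mapQ, Finset.forall_mem_image]

theorem hypSatM_of_mem_Eax (A : Alg I ar) {M : Set (Hyp I ar)} (hM : ∀ σ ∈ M, IsHyp σ)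
    {q : Quasi I ar} (hq : q ∈ Eax I ar) : A.HypSatM M q := by
  intro σ hσ
  rw [sat_mapQ]
  intro v hv
  rcases hq with ⟨p, rfl⟩ | ⟨p, r, rfl⟩ | ⟨p, r, s, rfl⟩ | ⟨f, t, s, rfl⟩
  · rfl
  · exact (hv (p, r) (by simp)).symm
  · exact (hv (p, r) (by simp)).trans (hv (r, s) (by simp))
  · simp only [Hyp.apply, eval_subst_s15]
    refine A.eval_congr fun n hn => ?_
    have hlt := hM σ hσ f n hn
    simpa [hlt] using hv (t ⟨n, hlt⟩, s ⟨n, hlt⟩)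
      (Finset.mem_image.2 ⟨⟨n, hlt⟩, Finset.mem_univ _, rfl⟩)

/-- Soundness of the calculus for `M`-hypersatisfaction. -/
theorem hypSatM_of_derMP (A : Alg I ar) {M : Set (Hyp I ar)} (hM : ∀ σ ∈ M, IsHyp σ)
    (hcomp : ∀ σ₁ ∈ M, ∀ σ₂ ∈ M, Hyp.comp σ₁ σ₂ ∈ M) {S : Set (Quasi I ar)}
    (hS : ∀ q ∈ S, A.HypSatM M q) {q : Quasi I ar} (hq : DerMP M S q) : A.HypSatM M q := by
  induction hq with
  | hyp h => exact hS _ h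
  | @subst q δ _ ih =>
    intro σ hσ
    have h := sat_mapQ.1 (ih σ hσ)
    rw [sat_mapQ]
    intro v hv
    simp only [mapQ, Finset.forall_mem_image, Hyp.apply_subst_s15 (hM σ hσ), eval_subst_s15] at hv ⊢
    exact h _ fun p hp => hv hp
  | @hypsub q σ' hσ' _ ih =>
    intro σ hσ
    have h := sat_mapQ.1 (ih _ (hcomp σ hσ σ' hσ'))
    rw [sat_mapQ]
    intro v hv
    simp only [Hyp.comp_apply (hM σ hσ)] at h
    simp only [mapQ, Finset.forall_mem_image] at hv ⊢
    exact h v fun p hp => hv hp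
  | mp _ _ ihα ihβ =>
    intro σ hσ
    have hα := sat_mapQ.1 (ihα σ hσ)
    have hβ := sat_mapQ.1 (ihβ σ hσ)
    rw [sat_mapQ]
    intro v hv
    refine hβ v fun p hp => ?_
    rcases Finset.mem_insert.1 hp with rfl | hp
    · exact hα v (by simp)
    · exact hv p hp

end Alg

namespace DerMP

variable {M : Set (Hyp I ar)} {S : Set (Quasi I ar)}

theorem discharge {Δ : Finset (Eqn I ar)} {β : Eqn I ar} (h : DerMP M S (Δ, β))
    (hΔ : ∀ p ∈ Δ, DerMP M S (∅, p)) : DerMP M S (∅, β) := by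
  induction Δ using Finset.induction_on with
  | empty => exact h
  | insert a Γ _ ih =>
    exact ih (mp (hΔ a (Finset.mem_insert_self a Γ)) h)
      fun p hp => hΔ p (Finset.mem_insert_of_mem hp)

/-- The relation of provable equality of terms. -/
def provSetoid (M : Set (Hyp I ar)) (S : Set (Quasi I ar)) : Setoid (Trm I ar) where
  r t s := DerMP M (Eax I ar ∪ S) (∅, (t, s))
  iseqv :=
    { refl := fun p => hyp (.inl (.inl ⟨p, rfl⟩))
      symm := fun {p r} h =>
        discharge (hyp (.inl (.inr (.inl ⟨p, r, rfl⟩)))) (by simpa using h)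
      trans := fun {p r s} h₁ h₂ =>
        discharge (hyp (.inl (.inr (.inr (.inl ⟨p, r, s, rfl⟩))))) (by simpa using ⟨h₁, h₂⟩) }

theorem app_congr {f : I} {t s : Fin (ar f) → Trm I ar}
    (h : ∀ i, DerMP M (Eax I ar ∪ S) (∅, (t i, s i))) :
    DerMP M (Eax I ar ∪ S) (∅, (.app f t, .app f s)) := by
  refine discharge (hyp (.inl (.inr (.inr (.inr ⟨f, t, s, rfl⟩))))) fun p hp => ?_
  obtain ⟨i, -, rfl⟩ := Finset.mem_image.1 hp
  exact h i

/-- The term algebra modulo provable equality. -/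
noncomputable def termAlg (M : Set (Hyp I ar)) (S : Set (Quasi I ar)) : Alg I ar where
  carrier := Quotient (provSetoid M S)
  ops f xs := Quotient.mk _ (.app f fun i => (xs i).out)

theorem eval_termAlg (δ : ℕ → Trm I ar) (t : Trm I ar) :
    (termAlg M S).eval (fun n => Quotient.mk (provSetoid M S) (δ n)) t =
      Quotient.mk (provSetoid M S) (t.subst δ) := by
  induction t with
  | var n => rfl
  | app f ts ih =>
    simp only [Alg.eval, ih]
    exact Quotient.sound (app_congr fun i => Quotient.mk_out (s := provSetoid M S) _)

theorem eval_termAlg_eq_iff (δ : ℕ → Trm I ar) (t s : Trm I ar) :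
    (termAlg M S).eval (fun n => Quotient.mk (provSetoid M S) (δ n)) t =
      (termAlg M S).eval (fun n => Quotient.mk (provSetoid M S) (δ n)) s ↔
      DerMP M (Eax I ar ∪ S) (∅, (t.subst δ, s.subst δ)) := by
  rw [eval_termAlg, eval_termAlg]
  exact Quotient.eq (r := provSetoid M S)

theorem hypSatM_termAlg {q : Quasi I ar} (hq : q ∈ S) : (termAlg M S).HypSatM M q := by
  intro σ hσ
  rw [Alg.sat_mapQ]
  intro v
  obtain ⟨δ, rfl⟩ : ∃ δ : ℕ → Trm I ar, v = fun n => Quotient.mk (provSetoid M S) (δ n) :=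
    ⟨fun n => Quotient.out (v n), funext fun n => (Quotient.out_eq (v n)).symm⟩
  simp only [eval_termAlg_eq_iff]
  intro hv
  refine discharge (subst δ (hypsub hσ (hyp (.inr hq)))) ?_
  simpa only [mapQ, Finset.forall_mem_image] using fun p => hv p

end DerMP

/-- Let `M` be a submonoid of `H(τ)`.  An identity `e` is an
`M`-hyperconsequence of a set `Σ` of quasi-identities if and only if, for every
hypersubstitution `σ ∈ M`, there is a derivation of `σ(e)` from `E ∪ Σ` using
only the substitution rule, the modus ponens rule and the `M`-hypersubstitution
rule. -/
theorem identity_M_hyperconsequence_iff (M : Set (Hyp I ar))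
    (hM : ∀ σ ∈ M, IsHyp σ) (hid : Hyp.id I ar ∈ M)
    (hcomp : ∀ σ₁ ∈ M, ∀ σ₂ ∈ M, Hyp.comp σ₁ σ₂ ∈ M)
    (S : Set (Quasi I ar)) (α : Eqn I ar) :
    (∀ A : Alg I ar, (∀ q ∈ S, A.HypSatM M q) → A.HypSatM M (∅, α)) ↔
      ∀ σ ∈ M, DerMP M (Eax I ar ∪ S) (mapQ (Hyp.apply σ) (∅, α)) := by
  constructor
  · intro h σ hσ
    have h' := Alg.sat_mapQ.1 (h (DerMP.termAlg M S) (fun _ => DerMP.hypSatM_termAlg) σ hσ)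
      (fun n => Quotient.mk (DerMP.provSetoid M S) (.var n)) (by simp)
    rw [DerMP.eval_termAlg_eq_iff, Trm.subst_var_s15, Trm.subst_var_s15] at h'
    simpa only [mapQ, Finset.image_empty] using h'
  · intro h A hA σ hσ
    have h' := Alg.sat_mapQ.1 (A.hypSatM_of_derMP hM hcomp
      (fun q hq => hq.elim (A.hypSatM_of_mem_Eax hM) (hA q)) (h σ hσ) _ hid)
    simp only [Hyp.id_apply_s15] at h'
    exact h'
end
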